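/- There exist constants α ∈ (0,1) and C > 0 depending only on n with the following property: if u is continuous on B₁⁺ ∪ T₁, harmonic on B₁⁺, u = 0 on T₁, and |u| ≤ M on B₁⁺ for some M ≥ 0, then there exists a real constant a with |a| ≤ C·M such that |u(x) − a·xₙ| ≤ C·|x|^α·xₙ·M for every x ∈ B₁⸝₂⁺. -/

import Mathlib

noncomputable section

/-- The Laplacian of `u : ℝⁿ → ℝ`. -/
def lapl {m : ℕ} (u : EuclideanSpace ℝ (Fin m) → ℝ) (x : EuclideanSpace ℝ (Fin m)) : ℝ :=
  ∑ i : Fin m, fderiv ℝ (fun y => fderiv ℝ u y (EuclideanSpace.single i 1)) x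
    (EuclideanSpace.single i 1)

/-- Harmonic on an open set: C² with vanishing Laplacian. -/
def IsHarmonicOn {m : ℕ} (u : EuclideanSpace ℝ (Fin m) → ℝ)
    (U : Set (EuclideanSpace ℝ (Fin m))) : Prop :=
  ContDiffOn ℝ 2 u U ∧ ∀ x ∈ U, lapl u x = 0

/-- The unit vector `eₙ` in dimension `n + 2`. -/
def en (n : ℕ) : EuclideanSpace ℝ (Fin (n + 2)) := EuclideanSpace.single (Fin.last (n + 1)) 1

/-- The upper half ball `B_r⁺`. -/
def halfBall (n : ℕ) (r : ℝ) : Set (EuclideanSpace ℝ (Fin (n + 2))) :=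
  {x | ‖x‖ < r ∧ 0 < x (Fin.last (n + 1))}

/-- The flat boundary part `T_r`. -/
def flatT (n : ℕ) (r : ℝ) : Set (EuclideanSpace ℝ (Fin (n + 2))) :=
  {x | ‖x‖ < r ∧ x (Fin.last (n + 1)) = 0}

open Filter Topology

lemma ContDiffAt.line {E : Type*} [NormedAddCommGroup E] [NormedSpace ℝ E] {u : E → ℝ} {x : E}
    (hu : ContDiffAt ℝ 2 u x) (e : E) : ContDiffAt ℝ 2 (fun t : ℝ => u (x + t • e)) 0 := by
  apply ContDiffAt.comp (g := u) (0 : ℝ) (by simpa using hu) 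
  fun_prop

lemma deriv_line {E : Type*} [NormedAddCommGroup E] [NormedSpace ℝ E] {u : E → ℝ} {x e : E}
    {t : ℝ} (hu : DifferentiableAt ℝ u (x + t • e)) :
    HasDerivAt (fun t : ℝ => u (x + t • e)) (fderiv ℝ u (x + t • e) e) t := by
  have h1 : HasDerivAt (fun t : ℝ => x + t • e) e t := by
    simpa using ((hasDerivAt_id t).smul_const e).const_add x
  exact hu.hasFDerivAt.comp_hasDerivAt t h1

lemma deriv_deriv_line {E : Type*} [NormedAddCommGroup E] [NormedSpace ℝ E] {u : E → ℝ} {x : E}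
    (hu : ContDiffAt ℝ 2 u x) (e : E) :
    deriv (deriv (fun t : ℝ => u (x + t • e))) 0 = fderiv ℝ (fun y => fderiv ℝ u y e) x e := by
  have h1 : ∀ᶠ y in 𝓝 x, DifferentiableAt ℝ u y := by
    filter_upwards [hu.eventually (by simp)] with y hy using hy.differentiableAt (by simp)
  have hl : Tendsto (fun t : ℝ => x + t • e) (𝓝 0) (𝓝 x) := by
    have : Continuous (fun t : ℝ => x + t • e) := by fun_prop
    simpa using this.tendsto 0
  have h2 : deriv (fun t : ℝ => u (x + t • e)) =ᶠ[𝓝 0]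
      fun t : ℝ => fderiv ℝ u (x + t • e) e := by
    filter_upwards [hl.eventually h1] with t ht using (deriv_line ht).deriv
  rw [h2.deriv_eq]
  have h3 : DifferentiableAt ℝ (fun y => fderiv ℝ u y e) x :=
    ((hu.fderiv_right (m := 1) (by norm_num)).differentiableAt (by simp)).clm_apply
      (differentiableAt_const _)
  have := deriv_line (u := fun y => fderiv ℝ u y e) (x := x) (e := e) (t := 0) (by simpa using h3)
  simpa using this.deriv

lemma lapl_eq_sum {m : ℕ} {u : EuclideanSpace ℝ (Fin m) → ℝ} {x : EuclideanSpace ℝ (Fin m)}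
    (hu : ContDiffAt ℝ 2 u x) :
    lapl u x = ∑ j, deriv (deriv (fun t : ℝ => u (x + t • EuclideanSpace.single j (1 : ℝ)))) 0 := by
  simp only [lapl, deriv_deriv_line hu]

lemma ContDiffAt.eventually_hasDerivAt {f : ℝ → ℝ} {a : ℝ} (hf : ContDiffAt ℝ 2 f a) :
    ∀ᶠ t in 𝓝 a, HasDerivAt f (deriv f t) t := by
  filter_upwards [hf.eventually (by simp)] with y hy using
    (hy.differentiableAt (by simp)).hasDerivAt

lemma ContDiffAt.hasDerivAt_deriv {f : ℝ → ℝ} {a : ℝ} (hf : ContDiffAt ℝ 2 f a) :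
    HasDerivAt (deriv f) (deriv (deriv f) a) a := by
  have h : ContDiffAt ℝ 1 (fun t => fderiv ℝ f t 1) a :=
    (hf.fderiv_right (m := 1) (by norm_num)).clm_apply contDiffAt_const
  exact (h.differentiableAt (by simp)).hasDerivAt

lemma deriv_deriv_le_of_isLocalMax {f : ℝ → ℝ} {b c : ℝ} (hf : ContDiffAt ℝ 2 f 0)
    (hmax : IsLocalMax (fun t => f t - (b * t + c * t ^ 2)) 0) : deriv (deriv f) 0 ≤ 2 * c := by
  set F : ℝ → ℝ := fun t => f t - (b * t + c * t ^ 2) with hF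
  have h1 : deriv F =ᶠ[𝓝 0] fun t => deriv f t - (b + 2 * c * t) := by
    filter_upwards [hf.eventually_hasDerivAt] with t ht
    have := ht.sub (((hasDerivAt_id t).const_mul b).add ((hasDerivAt_pow 2 t).const_mul c))
    refine (this.congr_deriv ?_).deriv
    simp; ring
  have h2 : deriv (deriv F) 0 = deriv (deriv f) 0 - 2 * c := by
    rw [h1.deriv_eq]
    have := hf.hasDerivAt_deriv.sub (((hasDerivAt_id (0 : ℝ)).const_mul (2 * c)).const_add b)
    exact (this.congr_deriv (by simp)).deriv
  by_contra! hlt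
  have hcont : ContinuousAt F 0 := by
    have := hf.continuousAt
    fun_prop
  have hmin := isLocalMin_of_deriv_deriv_pos (by rw [h2]; linarith) hmax.deriv_eq_zero hcont
  have hconst : F =ᶠ[𝓝 0] fun _ => F 0 := by
    filter_upwards [hmin, hmax] with t h h' using le_antisymm h' h
  have h3 : deriv F =ᶠ[𝓝 0] fun _ => 0 := by
    simpa using hconst.deriv
  have h4 := h3.deriv_eq
  simp only [deriv_const] at h4
  linarith

lemma abs_deriv_deriv_le {f : ℝ → ℝ} {A : ℝ} (hf : ContDiffAt ℝ 2 f 0)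
    (h : ∀ᶠ t in 𝓝 (0 : ℝ), |f t - 2 * f 0 + f (-t)| ≤ A * t ^ 2) :
    |deriv (deriv f) 0| ≤ A := by
  have hn : ContDiffAt ℝ 2 (fun t => f (-t)) 0 :=
    ContDiffAt.comp (g := f) (0 : ℝ) (by simpa using hf) (by fun_prop)
  set G : ℝ → ℝ := fun t => f t + f (-t)
  have hG : ContDiffAt ℝ 2 G 0 := hf.add hn
  have hG2 : deriv (deriv G) 0 = 2 * deriv (deriv f) 0 := by
    have h1 : deriv G =ᶠ[𝓝 0] fun t => deriv f t - deriv f (-t) := by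
      filter_upwards [hf.eventually_hasDerivAt, hn.eventually_hasDerivAt] with t h1 h2
      refine ((h1.add h2).congr_deriv ?_).deriv
      rw [deriv_comp_neg, sub_eq_add_neg]
    rw [h1.deriv_eq]
    have h2 := hf.hasDerivAt_deriv
    have h3 : HasDerivAt (fun t => deriv f (-t)) (-deriv (deriv f) 0) 0 := by
      have := HasDerivAt.scomp (0 : ℝ) (g₁ := deriv f) (h := fun t => -t)
        (by rwa [neg_zero]) (hasDerivAt_neg (0 : ℝ))
      simpa [Function.comp_def] using this
    exact ((h2.sub h3).congr_deriv (by ring)).deriv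
  have up := deriv_deriv_le_of_isLocalMax (b := 0) (c := A) hG (by
    filter_upwards [h] with t ht
    have := (abs_le.1 ht).2
    simp [G]; linarith)
  have hdn := deriv_deriv_le_of_isLocalMax (b := 0) (c := A) hG.neg (by
    filter_upwards [h] with t ht
    have := (abs_le.1 ht).1
    simp [G]; linarith)
  have : deriv (deriv fun t => -G t) 0 = - deriv (deriv G) 0 := by
    have : deriv (fun t => -G t) = fun t => -deriv G t := by ext t; exact deriv.fun_neg
    rw [this]; exact deriv.fun_neg
  rw [abs_le]; constructor <;> linarith

lemma norm_sub_add_single_sq {m : ℕ} (y p : EuclideanSpace ℝ (Fin m)) (j : Fin m) (t : ℝ) :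
    ‖y + t • EuclideanSpace.single j (1 : ℝ) - p‖ ^ 2 =
      ‖y - p‖ ^ 2 + (2 * (y j - p j) * t + t ^ 2) := by
  have : y + t • EuclideanSpace.single j (1 : ℝ) - p =
    (y - p) + t • EuclideanSpace.single j (1 : ℝ) := by abel
  rw [this, norm_add_sq_real, inner_smul_right, EuclideanSpace.inner_single_right, norm_smul]
  simp
  ring

lemma abs_apply_le_norm {m : ℕ} (y : EuclideanSpace ℝ (Fin m)) (i : Fin m) : |y i| ≤ ‖y‖ := by
  simpa using PiLp.norm_apply_le y i

lemma le_of_barrier {m : ℕ} (i l : Fin m) (p : EuclideanSpace ℝ (Fin m)) {r M : ℝ}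
    (hr : 0 < r) (hM : 0 < M) {w : EuclideanSpace ℝ (Fin m) → ℝ}
    (hc : ContinuousOn w {y | ‖y - p‖ ≤ r ∧ p i ≤ y i ∧ 0 ≤ y l})
    (hw : ∀ y, ‖y - p‖ < r → p i < y i → 0 < y l → ContDiffAt ℝ 2 w y ∧ lapl w y = 0)
    (h0 : ∀ y, ‖y - p‖ ≤ r → 0 ≤ y l → y i = p i ∨ y l = 0 → w y ≤ 0)
    (hwM : ∀ y, ‖y - p‖ ≤ r → 0 ≤ y l → w y ≤ M)
    {t : ℝ} (ht0 : 0 ≤ t) (htr : t ≤ r) (hl : 0 ≤ (p + t • EuclideanSpace.single i (1 : ℝ)) l) :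
    w (p + t • EuclideanSpace.single i (1 : ℝ)) ≤ (m + 2) * M / r * t := by
  set K : Set (EuclideanSpace ℝ (Fin m)) := {y | ‖y - p‖ ≤ r ∧ p i ≤ y i ∧ 0 ≤ y l} with hK
  set ψ : EuclideanSpace ℝ (Fin m) → ℝ := fun y =>
    M / r ^ 2 * (‖y - p‖ ^ 2 + (m + 1) * (r * (y i - p i) - (y i - p i) ^ 2)) with hψ
  have hψc : Continuous ψ := by fun_prop
  have hKc : IsCompact K := by
    refine (isCompact_closedBall p r).of_isClosed_subset ?_ ?_
    · have h1 : Continuous fun y : EuclideanSpace ℝ (Fin m) => ‖y - p‖ := by fun_prop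
      have h2 : ∀ j, Continuous fun y : EuclideanSpace ℝ (Fin m) => y j := fun j => by fun_prop
      exact (isClosed_le h1 continuous_const).inter
        ((isClosed_le continuous_const (h2 i)).inter (isClosed_le continuous_const (h2 l)))
    · intro y hy
      simpa [dist_eq_norm] using hy.1
  have hbd : ∀ y ∈ K, 0 ≤ r * (y i - p i) - (y i - p i) ^ 2 := by
    intro y hy
    have h1 := (abs_apply_le_norm (y - p) i).trans hy.1
    have h2 : y i - p i ≤ r := (le_abs_self _).trans (by simpa using h1)
    have := mul_nonneg (sub_nonneg.2 hy.2.1) (sub_nonneg.2 h2)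
    nlinarith
  have key : ∀ y ∈ K, w y - ψ y ≤ 0 := by
    by_contra! hcon
    obtain ⟨y₁, hy₁, hpos⟩ := hcon
    obtain ⟨y, hyK, hy⟩ := hKc.exists_isMaxOn ⟨y₁, hy₁⟩ (hc.sub hψc.continuousOn)
    have hposy : 0 < w y - ψ y := hpos.trans_le (hy hy₁)
    have hψ0 : M / r ^ 2 * ‖y - p‖ ^ 2 ≤ ψ y := by
      have := hbd y hyK
      simp only [hψ]
      gcongr
      have : 0 ≤ ((m : ℝ) + 1) * (r * (y i - p i) - (y i - p i) ^ 2) := by positivity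
      linarith
    have hψ1 : 0 ≤ ψ y := le_trans (by positivity) hψ0
    have hyr : ‖y - p‖ < r := by
      refine hyK.1.lt_of_ne fun h => ?_
      have := hwM y hyK.1 hyK.2.2
      rw [h, div_mul_cancel₀ _ (by positivity)] at hψ0
      linarith
    have hyi : p i < y i := by
      refine hyK.2.1.lt_of_ne fun h => ?_
      have := h0 y hyK.1 hyK.2.2 (Or.inl h.symm)
      linarith
    have hyl : 0 < y l := by
      refine hyK.2.2.lt_of_ne fun h => ?_
      have := h0 y hyK.1 hyK.2.2 (Or.inr h.symm)
      linarith
    have hnear : ∀ᶠ z in 𝓝 y, z ∈ K := by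
      filter_upwards [(isOpen_lt (f := fun z => ‖z - p‖) (g := fun _ => r) (by fun_prop)
          (by fun_prop)).mem_nhds hyr,
        (isOpen_lt (f := fun _ => p i) (g := fun z : EuclideanSpace ℝ (Fin m) => z i) (by fun_prop)
          (by fun_prop)).mem_nhds hyi,
        (isOpen_lt (f := fun _ => (0 : ℝ)) (g := fun z : EuclideanSpace ℝ (Fin m) => z l)
          (by fun_prop) (by fun_prop)).mem_nhds hyl] with z h1 h2 h3
      exact ⟨le_of_lt h1, le_of_lt h2, le_of_lt h3⟩
    obtain ⟨hwC, hwl⟩ := hw y hyr hyi hyl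
    rw [lapl_eq_sum hwC] at hwl
    have hj : ∀ j, deriv (deriv (fun t : ℝ => w (y + t • EuclideanSpace.single j (1 : ℝ)))) 0 ≤
        2 * (M / r ^ 2 * (1 - if i = j then (m + 1 : ℝ) else 0)) := by
      intro j
      refine deriv_deriv_le_of_isLocalMax
        (b := M / r ^ 2 * (2 * (y j - p j) +
          if i = j then (m + 1) * (r - 2 * (y i - p i)) else 0)) (hwC.line _) ?_
      have hl : Tendsto (fun t : ℝ => y + t • EuclideanSpace.single j (1 : ℝ)) (𝓝 0) (𝓝 y) := by
        have : Continuous (fun t : ℝ => y + t • EuclideanSpace.single j (1 : ℝ)) := by fun_prop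
        simpa using this.tendsto 0
      filter_upwards [hl.eventually hnear] with s hs
      have h1 : w (y + s • EuclideanSpace.single j (1 : ℝ)) -
        ψ (y + s • EuclideanSpace.single j (1 : ℝ)) ≤ w y - ψ y := hy hs
      have h2 : ψ (y + s • EuclideanSpace.single j (1 : ℝ)) = ψ y + (M / r ^ 2 * (2 * (y j - p j) +
          if i = j then (m + 1) * (r - 2 * (y i - p i)) else 0) * s +
          M / r ^ 2 * (1 - if i = j then (m + 1 : ℝ) else 0) * s ^ 2) := by
        simp only [hψ]
        rw [norm_sub_add_single_sq]
        by_cases hij : i = j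
        · subst hij; simp; ring
        · simp [hij]; ring
      simp only [zero_smul, add_zero]
      linarith
    have hsum := Finset.sum_le_sum fun j (_ : j ∈ Finset.univ) => hj j
    rw [hwl, ← Finset.mul_sum, ← Finset.mul_sum, Finset.sum_sub_distrib] at hsum
    simp at hsum
    have : 0 < M / r ^ 2 := by positivity
    linarith
  have hin : p + t • EuclideanSpace.single i (1 : ℝ) ∈ K := by
    refine ⟨?_, ?_, hl⟩
    · simpa [norm_smul, abs_of_nonneg ht0] using htr
    · simpa using ht0
  have h := key _ hin
  have h2 : ψ (p + t • EuclideanSpace.single i (1 : ℝ)) ≤ (m + 2) * M / r * t := by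
    simp only [hψ]
    rw [norm_sub_add_single_sq]
    have e : (m + 2) * M / r * t = M / r ^ 2 * ((m + 2) * (r * t)) := by field_simp
    rw [e]
    gcongr
    simp
    nlinarith [mul_nonneg ht0 (sub_nonneg.2 htr), mul_nonneg (Nat.cast_nonneg (α := ℝ) m) (sq_nonneg t)]
  linarith

lemma lapl_sub {m : ℕ} {u v : EuclideanSpace ℝ (Fin m) → ℝ} {x : EuclideanSpace ℝ (Fin m)}
    (hu : ContDiffAt ℝ 2 u x) (hv : ContDiffAt ℝ 2 v x) :
    lapl (fun y => u y - v y) x = lapl u x - lapl v x := by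
  rw [lapl_eq_sum hu, lapl_eq_sum hv, lapl_eq_sum (hu.sub hv), ← Finset.sum_sub_distrib]
  refine Finset.sum_congr rfl fun j _ => ?_
  have h1 := hu.line (EuclideanSpace.single j (1 : ℝ))
  have h2 := hv.line (EuclideanSpace.single j (1 : ℝ))
  refine Eq.trans (Filter.EventuallyEq.deriv_eq ?_)
    (h1.hasDerivAt_deriv.sub h2.hasDerivAt_deriv).deriv
  filter_upwards [h1.eventually_hasDerivAt, h2.eventually_hasDerivAt] with t h1 h2 using
    (h1.sub h2).deriv

lemma lapl_neg {m : ℕ} (u : EuclideanSpace ℝ (Fin m) → ℝ) (x : EuclideanSpace ℝ (Fin m)) :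
    lapl (fun y => -u y) x = -lapl u x := by
  simp [lapl, fderiv_fun_neg]

lemma lapl_comp_add {m : ℕ} (u : EuclideanSpace ℝ (Fin m) → ℝ) (c x : EuclideanSpace ℝ (Fin m)) :
    lapl (fun y => u (y + c)) x = lapl u (x + c) := by
  simp only [lapl, fderiv_comp_add_right]
  refine Finset.sum_congr rfl fun j _ => ?_
  rw [fderiv_comp_add_right (f := fun y => fderiv ℝ u y (EuclideanSpace.single j 1)) c]

/-- Reflection across the hyperplane `{y | y i = a}`. -/
def reflectCoord {m : ℕ} (i : Fin m) (a : ℝ) (y : EuclideanSpace ℝ (Fin m)) :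
    EuclideanSpace ℝ (Fin m) :=
  y - (2 * (y i - a)) • EuclideanSpace.single i (1 : ℝ)

lemma contDiff_reflectCoord {m : ℕ} (i : Fin m) (a : ℝ) : ContDiff ℝ 2 (reflectCoord i a) := by
  unfold reflectCoord
  fun_prop

lemma reflectCoord_apply_of_ne {m : ℕ} {i j : Fin m} (h : j ≠ i) (a : ℝ)
    (y : EuclideanSpace ℝ (Fin m)) : reflectCoord i a y j = y j := by
  simp [reflectCoord, h]

lemma reflectCoord_of_eq {m : ℕ} {i : Fin m} {a : ℝ} {y : EuclideanSpace ℝ (Fin m)}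
    (h : y i = a) : reflectCoord i a y = y := by
  simp [reflectCoord, h]

lemma norm_reflectCoord_sub {m : ℕ} (i : Fin m) (p y : EuclideanSpace ℝ (Fin m)) :
    ‖reflectCoord i (p i) y - p‖ = ‖y - p‖ := by
  have h := norm_sub_add_single_sq y p i (-(2 * (y i - p i)))
  rw [neg_smul, ← sub_eq_add_neg] at h
  rw [← sq_eq_sq₀ (norm_nonneg _) (norm_nonneg _), reflectCoord, h]
  ring

lemma lapl_comp_reflectCoord {m : ℕ} {u : EuclideanSpace ℝ (Fin m) → ℝ} (i : Fin m) (a : ℝ)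
    {x : EuclideanSpace ℝ (Fin m)} (hu : ContDiffAt ℝ 2 u (reflectCoord i a x)) :
    lapl (fun y => u (reflectCoord i a y)) x = lapl u (reflectCoord i a x) := by
  have hR : ContDiffAt ℝ 2 (fun y => u (reflectCoord i a y)) x :=
    hu.comp x (contDiff_reflectCoord i a).contDiffAt
  rw [lapl_eq_sum hu, lapl_eq_sum hR]
  refine Finset.sum_congr rfl fun j _ => ?_
  set f : ℝ → ℝ := fun t => u (reflectCoord i a x + t • EuclideanSpace.single j (1 : ℝ)) with hf
  by_cases hij : i = j
  · subst hij
    have h1 : (fun t : ℝ => u (reflectCoord i a (x + t • EuclideanSpace.single i (1 : ℝ)))) =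
        fun t => f (-t) := by
      ext t
      simp only [hf, reflectCoord]
      congr 1
      simp
      module
    have h2 : deriv (fun t => f (-t)) = fun t => -deriv f (-t) := by
      ext t; exact deriv_comp_neg f t
    rw [h1, h2, deriv.fun_neg, deriv_comp_neg]
    simp
  · congr 2
    ext t
    simp only [hf, reflectCoord]
    congr 1
    simp [hij]
    abel

/-- Solutions of the Dirichlet problem on a half ball, bounded by `M`, with zero data on the flat
part. -/
structure IsHalfBallSol (n : ℕ) (ρ M : ℝ) (u : EuclideanSpace ℝ (Fin (n + 2)) → ℝ) : Prop where
  continuousOn : ContinuousOn u (halfBall n ρ ∪ flatT n ρ)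
  contDiffAt : ∀ x ∈ halfBall n ρ, ContDiffAt ℝ 2 u x
  lapl_eq_zero : ∀ x ∈ halfBall n ρ, lapl u x = 0
  eq_zero : ∀ x ∈ flatT n ρ, u x = 0
  abs_le : ∀ x ∈ halfBall n ρ, |u x| ≤ M

lemma isOpen_halfBall (n : ℕ) (ρ : ℝ) : IsOpen (halfBall n ρ) := by
  have h : Continuous fun x : EuclideanSpace ℝ (Fin (n + 2)) => x (Fin.last (n + 1)) := by fun_prop
  exact (isOpen_lt continuous_norm continuous_const).inter (isOpen_lt continuous_const h)

lemma mem_halfBall_union_flatT {n : ℕ} {ρ : ℝ} {x : EuclideanSpace ℝ (Fin (n + 2))} :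
    x ∈ halfBall n ρ ∪ flatT n ρ ↔ ‖x‖ < ρ ∧ 0 ≤ x (Fin.last (n + 1)) := by
  simp only [halfBall, flatT, Set.mem_union, Set.mem_ofPred_eq, le_iff_lt_or_eq, ← and_or_left,
    eq_comm]

namespace IsHalfBallSol

variable {n : ℕ} {ρ M : ℝ} {u : EuclideanSpace ℝ (Fin (n + 2)) → ℝ}

lemma neg (hu : IsHalfBallSol n ρ M u) : IsHalfBallSol n ρ M (fun x => -u x) where
  continuousOn := hu.continuousOn.neg
  contDiffAt x hx := (hu.contDiffAt x hx).neg
  lapl_eq_zero x hx := by rw [lapl_neg, hu.lapl_eq_zero x hx, neg_zero]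
  eq_zero x hx := by rw [hu.eq_zero x hx, neg_zero]
  abs_le x hx := by rw [abs_neg]; exact hu.abs_le x hx

lemma abs_le_of_nonneg (hu : IsHalfBallSol n ρ M u) (hM : 0 < M)
    {x : EuclideanSpace ℝ (Fin (n + 2))} (hx : ‖x‖ < ρ) (hl : 0 ≤ x (Fin.last (n + 1))) :
    |u x| ≤ M := by
  rcases hl.lt_or_eq with h | h
  · exact hu.abs_le x ⟨hx, h⟩
  · rw [hu.eq_zero x ⟨hx, h.symm⟩, abs_zero]; exact hM.le

lemma le_mul_height (hu : IsHalfBallSol n ρ M u) (hM : 0 < M) {r : ℝ} (hr : 0 < r)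
    {x : EuclideanSpace ℝ (Fin (n + 2))} (hx : x ∈ halfBall n (ρ - r)) :
    u x ≤ (n + 4) * M / r * x (Fin.last (n + 1)) := by
  obtain ⟨hxρ, hxl⟩ := hx
  rcases le_total r (x (Fin.last (n + 1))) with h | h
  · have h1 := (le_abs_self _).trans (hu.abs_le x ⟨by linarith, hxl⟩)
    refine h1.trans ?_
    have : (n + 4) * M / r * x (Fin.last (n + 1)) = M * ((n + 4) * (x (Fin.last (n + 1)) / r)) := by
      field_simp
    rw [this]
    have h2 : 1 ≤ x (Fin.last (n + 1)) / r := (one_le_div hr).2 h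
    have h3 : (1 : ℝ) ≤ n + 4 := by have := Nat.cast_nonneg (α := ℝ) n; linarith
    exact le_mul_of_one_le_right hM.le (one_le_mul_of_one_le_of_one_le h3 h2)
  set p := x - x (Fin.last (n + 1)) • EuclideanSpace.single (Fin.last (n + 1)) (1 : ℝ) with hp
  have hpl : p (Fin.last (n + 1)) = 0 := by simp [hp]
  have hpn : ‖p‖ ≤ ‖x‖ := by
    have h := norm_sub_add_single_sq x 0 (Fin.last (n + 1)) (-x (Fin.last (n + 1)))
    rw [neg_smul, ← sub_eq_add_neg, sub_zero, sub_zero, ← hp] at h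
    rw [← sq_le_sq₀ (norm_nonneg _) (norm_nonneg _), h]
    simp only [PiLp.zero_apply]
    nlinarith
  have hball : ∀ y, ‖y - p‖ ≤ r → ‖y‖ < ρ := fun y hy => by
    have := norm_add_le (y - p) p
    rw [sub_add_cancel] at this
    linarith
  have hx : p + x (Fin.last (n + 1)) • EuclideanSpace.single (Fin.last (n + 1)) (1 : ℝ) = x := by
    simp [hp]
  have := le_of_barrier (Fin.last (n + 1)) (Fin.last (n + 1)) p hr hM (w := u)
    (hu.continuousOn.mono fun y hy => mem_halfBall_union_flatT.2 ⟨hball y hy.1, hy.2.2⟩)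
    (fun y h1 _ h3 => ⟨hu.contDiffAt y ⟨hball y h1.le, h3⟩, hu.lapl_eq_zero y ⟨hball y h1.le, h3⟩⟩)
    (fun y h1 _ h3 => (hu.eq_zero y ⟨hball y h1, by simpa [hpl] using h3⟩).le)
    (fun y h1 h2 => (le_abs_self _).trans (hu.abs_le_of_nonneg hM (hball y h1) h2))
    hxl.le h (by rw [hx]; exact hxl.le)
  rw [hx] at this
  refine this.trans_eq ?_
  push_cast; ring

lemma abs_le_mul_height (hu : IsHalfBallSol n ρ M u) (hM : 0 < M) {r : ℝ} (hr : 0 < r)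
    {x : EuclideanSpace ℝ (Fin (n + 2))} (hx : x ∈ halfBall n (ρ - r)) :
    |u x| ≤ (n + 4) * M / r * x (Fin.last (n + 1)) :=
  abs_le'.2 ⟨hu.le_mul_height hM hr hx, hu.neg.le_mul_height hM hr hx⟩

lemma sub_le_of_tangential (hu : IsHalfBallSol n ρ M u) (hM : 0 < M) {r : ℝ} (hr : 0 < r)
    {i : Fin (n + 2)} (hi : i ≠ Fin.last (n + 1)) {x : EuclideanSpace ℝ (Fin (n + 2))}
    (hx : ‖x‖ < ρ - r) (hxl : 0 ≤ x (Fin.last (n + 1))) {t : ℝ} (ht0 : 0 ≤ t) (htr : t ≤ r) :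
    u (x + t • EuclideanSpace.single i (1 : ℝ)) - u (x - t • EuclideanSpace.single i (1 : ℝ)) ≤
      (n + 4) * (2 * M) / r * t := by
  have hball : ∀ y, ‖y - x‖ ≤ r → ‖y‖ < ρ := fun y hy => by
    have := norm_add_le (y - x) x
    rw [sub_add_cancel] at this
    linarith
  have hballR : ∀ y, ‖y - x‖ ≤ r → ‖reflectCoord i (x i) y‖ < ρ := fun y hy =>
    hball _ (by rwa [norm_reflectCoord_sub])
  have hRl : ∀ y, reflectCoord i (x i) y (Fin.last (n + 1)) = y (Fin.last (n + 1)) :=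
    reflectCoord_apply_of_ne hi.symm _
  have := le_of_barrier i (Fin.last (n + 1)) x hr (M := 2 * M) (by positivity)
    (w := fun y => u y - u (reflectCoord i (x i) y)) (t := t)
    ?_ ?_ ?_ ?_ ht0 htr (by simpa [hi.symm] using hxl)
  · have hR : reflectCoord i (x i) (x + t • EuclideanSpace.single i (1 : ℝ)) =
        x - t • EuclideanSpace.single i (1 : ℝ) := by
      simp [reflectCoord]
      module
    rw [hR] at this
    refine this.trans_eq ?_
    push_cast; ring
  · refine ContinuousOn.sub (hu.continuousOn.mono fun y hy =>
      mem_halfBall_union_flatT.2 ⟨hball y hy.1, hy.2.2⟩) ?_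
    refine hu.continuousOn.comp (contDiff_reflectCoord i (x i)).continuous.continuousOn fun y hy => ?_
    exact mem_halfBall_union_flatT.2 ⟨hballR y hy.1, by rw [hRl]; exact hy.2.2⟩
  · intro y h1 _ h3
    have m1 : y ∈ halfBall n ρ := ⟨hball y h1.le, h3⟩
    have m2 : reflectCoord i (x i) y ∈ halfBall n ρ := ⟨hballR y h1.le, by rw [hRl]; exact h3⟩
    have c1 := hu.contDiffAt _ m1
    have c2 := hu.contDiffAt _ m2
    have c3 : ContDiffAt ℝ 2 (fun y => u (reflectCoord i (x i) y)) y :=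
      c2.comp y (contDiff_reflectCoord i (x i)).contDiffAt
    refine ⟨c1.sub c3, ?_⟩
    rw [lapl_sub c1 c3, lapl_comp_reflectCoord i (x i) c2,
      hu.lapl_eq_zero _ m1, hu.lapl_eq_zero _ m2, sub_zero]
  · rintro y h1 - (h | h)
    · simp [reflectCoord_of_eq h]
    · rw [hu.eq_zero y ⟨hball y h1, h⟩, hu.eq_zero _ ⟨hballR y h1, by rw [hRl]; exact h⟩, sub_zero]
  · intro y h1 h2
    have a1 := hu.abs_le_of_nonneg hM (hball y h1) h2
    have a2 := hu.abs_le_of_nonneg hM (hballR y h1) (by rw [hRl]; exact h2)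
    rw [abs_le'] at a1 a2
    linarith

lemma symmDiff (hu : IsHalfBallSol n ρ M u) (hM : 0 < M) {r : ℝ} (hr : 0 < r)
    {i : Fin (n + 2)} (hi : i ≠ Fin.last (n + 1)) {h : ℝ} (h0 : 0 < h) (hhr : h ≤ r) :
    IsHalfBallSol n (ρ - r) ((n + 4) * (2 * M) / r * h)
      (fun x => u (x + h • EuclideanSpace.single i (1 : ℝ)) -
        u (x - h • EuclideanSpace.single i (1 : ℝ))) := by
  set e : EuclideanSpace ℝ (Fin (n + 2)) := h • EuclideanSpace.single i (1 : ℝ) with he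
  have hen : ‖e‖ ≤ r := by simpa [he, norm_smul, abs_of_pos h0] using hhr
  have hel : e (Fin.last (n + 1)) = 0 := by simp [he, hi.symm]
  have h1 : ∀ x : EuclideanSpace ℝ (Fin (n + 2)), ‖x‖ < ρ - r → ‖x + e‖ < ρ := fun x hx => by
    have := norm_add_le x e; linarith
  have h2 : ∀ x : EuclideanSpace ℝ (Fin (n + 2)), ‖x‖ < ρ - r → ‖x - e‖ < ρ := fun x hx => by
    have := norm_sub_le x e; linarith
  have m1 : ∀ x ∈ halfBall n (ρ - r), x + e ∈ halfBall n ρ := fun x hx =>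
    ⟨h1 x hx.1, by simpa [hel] using hx.2⟩
  have m2 : ∀ x ∈ halfBall n (ρ - r), x + -e ∈ halfBall n ρ := fun x hx =>
    ⟨by rw [← sub_eq_add_neg]; exact h2 x hx.1, by simpa [hel] using hx.2⟩
  have c1 : ∀ c : EuclideanSpace ℝ (Fin (n + 2)), ∀ x, x + c ∈ halfBall n ρ →
      ContDiffAt ℝ 2 (fun y => u (y + c)) x := fun c x hx =>
    ContDiffAt.comp (g := u) x (hu.contDiffAt _ hx) (by fun_prop)
  refine ⟨?_, ?_, ?_, ?_, ?_⟩
  · refine ContinuousOn.sub (hu.continuousOn.comp (by fun_prop) fun x hx => ?_)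
      (hu.continuousOn.comp (by fun_prop) fun x hx => ?_)
    · rw [mem_halfBall_union_flatT] at hx ⊢
      exact ⟨h1 x hx.1, by simpa [hel] using hx.2⟩
    · rw [mem_halfBall_union_flatT] at hx ⊢
      exact ⟨h2 x hx.1, by simpa [hel] using hx.2⟩
  · intro x hx
    simp only [sub_eq_add_neg _ e]
    exact (c1 _ x (m1 x hx)).sub (c1 _ x (m2 x hx))
  · intro x hx
    simp only [sub_eq_add_neg _ e]
    rw [lapl_sub (c1 _ x (m1 x hx)) (c1 _ x (m2 x hx)), lapl_comp_add, lapl_comp_add,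
      hu.lapl_eq_zero _ (m1 x hx), hu.lapl_eq_zero _ (m2 x hx), sub_zero]
  · intro x hx
    rw [hu.eq_zero _ ⟨h1 x hx.1, by simpa [hel] using hx.2⟩,
      hu.eq_zero _ ⟨h2 x hx.1, by simpa [hel] using hx.2⟩, sub_zero]
  · intro x hx
    rw [abs_le']
    refine ⟨hu.sub_le_of_tangential hM hr hi hx.1 hx.2.le h0.le hhr, ?_⟩
    have := hu.neg.sub_le_of_tangential hM hr hi hx.1 hx.2.le h0.le hhr
    simp only [he]
    linarith

end IsHalfBallSol

lemma exists_slope_of_deriv_deriv_le {f : ℝ → ℝ} {L T : ℝ} (hL : 0 ≤ L)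
    (hc : ContinuousOn f (Set.Ico 0 T)) (h0 : f 0 = 0)
    (hf : ∀ t ∈ Set.Ioo 0 T, ContDiffAt ℝ 2 f t)
    (hf2 : ∀ t ∈ Set.Ioo 0 T, |deriv (deriv f) t| ≤ L) :
    ∃ a, ∀ t ∈ Set.Ioo 0 T, |f t - a * t| ≤ L * t ^ 2 := by
  have hlip : LipschitzOnWith L.toNNReal (deriv f) (Set.Ioo 0 T) := by
    refine (convex_Ioo 0 T).lipschitzOnWith_of_nnnorm_hasDerivWithin_le
      (fun t ht => (hf t ht).hasDerivAt_deriv.hasDerivWithinAt) fun t ht => ?_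
    rw [← NNReal.coe_le_coe, Real.coe_toNNReal L hL]
    exact hf2 t ht
  obtain ⟨g, hg, hgf⟩ := hlip.extend_real
  refine ⟨g 0, fun t ht => ?_⟩
  obtain ⟨s, hs, hst⟩ := exists_deriv_eq_slope f ht.1
    (hc.mono fun s hs => ⟨hs.1, hs.2.trans_lt ht.2⟩)
    (fun s hs => ((hf s ⟨hs.1, hs.2.trans ht.2⟩).differentiableAt (by simp)).differentiableWithinAt)
  have h1 : |deriv f s - g 0| ≤ L * t := by
    have h2 := hg.dist_le_mul s 0
    rw [Real.coe_toNNReal L hL, ← hgf ⟨hs.1, hs.2.trans ht.2⟩, Real.dist_eq, Real.dist_eq, sub_zero,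
      abs_of_pos hs.1] at h2
    exact h2.trans (mul_le_mul_of_nonneg_left hs.2.le hL)
  have h3 : f t - g 0 * t = (deriv f s - g 0) * t := by
    have := ht.1.ne'
    rw [hst, h0]
    field_simp
    ring
  rw [h3, abs_mul, abs_of_pos ht.1, sq, ← mul_assoc]
  exact mul_le_mul_of_nonneg_right h1 ht.1.le

namespace IsHalfBallSol

variable {n : ℕ} {M : ℝ} {u : EuclideanSpace ℝ (Fin (n + 2)) → ℝ}

lemma abs_fderiv_le_of_tangential (hu : IsHalfBallSol n 1 M u) (hM : 0 < M)
    {i : Fin (n + 2)} (hi : i ≠ Fin.last (n + 1)) {x : EuclideanSpace ℝ (Fin (n + 2))}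
    (hx : x ∈ halfBall n (3 / 4)) :
    |fderiv ℝ u x (EuclideanSpace.single i 1)| ≤ 64 * (n + 4) ^ 2 * M * x (Fin.last (n + 1)) := by
  set e : EuclideanSpace ℝ (Fin (n + 2)) := EuclideanSpace.single i 1 with he
  have hxl := hx.2
  have hpos : ∀ t : ℝ, 0 < t → t ≤ 1 / 8 →
      |u (x + t • e) - u (x - t • e)| ≤ 128 * (n + 4) ^ 2 * M * x (Fin.last (n + 1)) * t := by
    intro t ht0 ht
    have h := (hu.symmDiff hM (by norm_num : (0 : ℝ) < 1 / 8) hi ht0 ht).abs_le_mul_height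
      (by positivity) (by norm_num : (0 : ℝ) < 1 / 8) (x := x) (by norm_num; exact hx)
    refine h.trans_eq ?_
    ring
  have hd : DifferentiableAt ℝ u x :=
    (hu.contDiffAt x ⟨hx.1.trans (by norm_num), hx.2⟩).differentiableAt (by simp)
  have hF : HasDerivAt (fun t : ℝ => u (x + t • e) - u (x - t • e)) (2 * fderiv ℝ u x e) 0 := by
    have h1 := deriv_line (u := u) (x := x) (e := e) (t := 0) (by simpa using hd)
    have h2 := deriv_line (u := u) (x := x) (e := -e) (t := 0) (by simpa using hd)
    simp only [smul_neg, ← sub_eq_add_neg] at h2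
    refine (h1.sub h2).congr_deriv ?_
    simp
    ring
  have h := hF.le_of_lip' (C := 128 * (n + 4) ^ 2 * M * x (Fin.last (n + 1))) (by positivity) ?_
  · rw [Real.norm_eq_abs, abs_mul, abs_two] at h
    linarith
  · filter_upwards [Metric.ball_mem_nhds (0 : ℝ) (by norm_num : (0 : ℝ) < 1 / 8)] with t ht
    rw [Metric.mem_ball, Real.dist_eq, sub_zero] at ht
    simp only [zero_smul, add_zero, sub_zero, sub_self, Real.norm_eq_abs]
    rcases lt_trichotomy t 0 with h | h | h
    · rw [abs_of_neg h] at ht ⊢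
      have := hpos (-t) (by linarith) ht.le
      rwa [neg_smul, sub_neg_eq_add, ← sub_eq_add_neg, abs_sub_comm] at this
    · simp [h]
    · rw [abs_of_pos h] at ht ⊢
      exact hpos t h ht.le

lemma abs_deriv_deriv_line_le_of_tangential (hu : IsHalfBallSol n 1 M u) (hM : 0 < M)
    {i : Fin (n + 2)} (hi : i ≠ Fin.last (n + 1)) {x : EuclideanSpace ℝ (Fin (n + 2))}
    (hx : x ∈ halfBall n (5 / 8)) :
    |deriv (deriv fun t : ℝ => u (x + t • EuclideanSpace.single i (1 : ℝ))) 0| ≤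
      512 * (n + 4) ^ 3 * M * x (Fin.last (n + 1)) := by
  set e : EuclideanSpace ℝ (Fin (n + 2)) := EuclideanSpace.single i 1 with he
  have hxl := hx.2
  have hpos : ∀ t : ℝ, 0 < t → t ≤ 1 / 4 →
      |u (x + t • e) - 2 * u x + u (x - t • e)| ≤
        512 * (n + 4) ^ 3 * M * x (Fin.last (n + 1)) * t ^ 2 := by
    intro t ht0 ht
    have h8 : (0 : ℝ) < 1 / 8 := by norm_num
    have h1 := hu.symmDiff hM h8 hi (half_pos ht0) (by linarith)
    have h2 := (h1.symmDiff (by positivity) h8 hi (half_pos ht0)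
      (by linarith)).abs_le_mul_height (by positivity) h8 (x := x) (by norm_num; exact hx)
    rw [← he] at h2
    have e1 : x + (t / 2) • e + (t / 2) • e = x + t • e := by module
    have e2 : x - (t / 2) • e - (t / 2) • e = x - t • e := by module
    rw [e1, e2, add_sub_cancel_right, sub_add_cancel] at h2
    refine (le_of_eq ?_).trans (h2.trans_eq ?_)
    · congr 1; ring
    · ring
  have hC := hu.contDiffAt x ⟨hx.1.trans (by norm_num), hx.2⟩
  refine abs_deriv_deriv_le (hC.line e) ?_
  filter_upwards [Metric.ball_mem_nhds (0 : ℝ) (by norm_num : (0 : ℝ) < 1 / 4)] with t ht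
  rw [Metric.mem_ball, Real.dist_eq, sub_zero] at ht
  simp only [zero_smul, add_zero, neg_smul, ← sub_eq_add_neg]
  rcases lt_trichotomy t 0 with h | h | h
  · rw [abs_of_neg h] at ht
    have := hpos (-t) (by linarith) ht.le
    rw [neg_smul, sub_neg_eq_add, ← sub_eq_add_neg, neg_sq] at this
    refine (le_of_eq ?_).trans this
    congr 1; ring
  · subst h
    simp; ring_nf
  · rw [abs_of_pos h] at ht
    exact hpos t h ht.le

lemma abs_deriv_deriv_normal_le (hu : IsHalfBallSol n 1 M u) (hM : 0 < M)
    {x : EuclideanSpace ℝ (Fin (n + 2))} (hx : x ∈ halfBall n (5 / 8)) :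
    |deriv (deriv fun t : ℝ => u (x + t • EuclideanSpace.single (Fin.last (n + 1)) (1 : ℝ))) 0| ≤
      512 * (n + 4) ^ 4 * M := by
  have hx1 : x ∈ halfBall n 1 := ⟨hx.1.trans (by norm_num), hx.2⟩
  have h := hu.lapl_eq_zero x hx1
  rw [lapl_eq_sum (hu.contDiffAt x hx1), ← Finset.add_sum_erase _ _
    (Finset.mem_univ (Fin.last (n + 1)))] at h
  rw [eq_neg_of_add_eq_zero_left h, abs_neg]
  have hxl : x (Fin.last (n + 1)) ≤ 1 :=
    (le_abs_self _).trans ((abs_apply_le_norm x _).trans hx1.1.le)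
  refine (Finset.abs_sum_le_sum_abs _ _).trans ((Finset.sum_le_card_nsmul _ _
    (512 * (n + 4) ^ 3 * M) fun i hi => ?_).trans ?_)
  · refine (hu.abs_deriv_deriv_line_le_of_tangential hM (Finset.ne_of_mem_erase hi) hx).trans ?_
    exact mul_le_of_le_one_right (by positivity) hxl
  · rw [Finset.card_erase_of_mem (Finset.mem_univ _), Finset.card_univ, Fintype.card_fin,
      nsmul_eq_mul]
    have : ((n + 2 - 1 : ℕ) : ℝ) ≤ n + 4 := by push_cast; linarith
    refine (mul_le_mul_of_nonneg_right this (by positivity)).trans_eq ?_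
    ring

lemma abs_sub_normal_le (hu : IsHalfBallSol n 1 M u) (hM : 0 < M)
    {x : EuclideanSpace ℝ (Fin (n + 2))} (hx : x ∈ halfBall n (3 / 4)) :
    |u x - u (x (Fin.last (n + 1)) • EuclideanSpace.single (Fin.last (n + 1)) (1 : ℝ))| ≤
      64 * (n + 4) ^ 3 * M * ‖x‖ * x (Fin.last (n + 1)) := by
  set l := Fin.last (n + 1) with hl
  have hxl : 0 < x l := hx.2
  set p : EuclideanSpace ℝ (Fin (n + 2)) := x l • EuclideanSpace.single l (1 : ℝ) with hp
  set d : EuclideanSpace ℝ (Fin (n + 2)) := x - p with hd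
  have hdl : d l = 0 := by simp [hd, hp]
  have hdsum : d = ∑ i ∈ Finset.univ.erase l, x i • EuclideanSpace.single i (1 : ℝ) := by
    rw [hd, sub_eq_iff_eq_add, hp, Finset.sum_erase_add _ _ (Finset.mem_univ l)]
    ext j
    simp [Pi.single_apply]
  have hpx : ‖p‖ ≤ ‖x‖ := by
    rw [hp, norm_smul]
    simpa using abs_apply_le_norm x l
  have hseg : ∀ t ∈ Set.Icc (0 : ℝ) 1, p + t • d ∈ halfBall n (3 / 4) := by
    intro t ht
    constructor
    · have e1 : p + t • d = (1 - t) • p + t • x := by rw [hd]; module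
      rw [e1]
      refine (norm_add_le _ _).trans_lt ?_
      rw [norm_smul _ p, norm_smul t x, Real.norm_of_nonneg ht.1, Real.norm_of_nonneg (sub_nonneg.2 ht.2)]
      have := mul_le_mul_of_nonneg_left hpx (sub_nonneg.2 ht.2)
      have := hx.1
      linarith
    · simpa [← hl, hdl, hp] using hxl
  have hbound : ∀ y ∈ halfBall n (3 / 4), y l = x l →
      |fderiv ℝ u y d| ≤ 64 * (n + 4) ^ 3 * M * ‖x‖ * x l := by
    intro y hy hyl
    rw [hdsum, map_sum]
    refine (Finset.abs_sum_le_sum_abs _ _).trans ((Finset.sum_le_card_nsmul _ _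
      (‖x‖ * (64 * (n + 4) ^ 2 * M * x l)) fun i hi => ?_).trans ?_)
    · rw [map_smul, smul_eq_mul, abs_mul]
      refine mul_le_mul (abs_apply_le_norm x i) ?_ (abs_nonneg _) (norm_nonneg _)
      rw [← hyl]
      exact hu.abs_fderiv_le_of_tangential hM (Finset.ne_of_mem_erase hi) hy
    · rw [Finset.card_erase_of_mem (Finset.mem_univ _), Finset.card_univ, Fintype.card_fin,
        nsmul_eq_mul]
      have : ((n + 2 - 1 : ℕ) : ℝ) ≤ n + 4 := by push_cast; linarith
      refine (mul_le_mul_of_nonneg_right this (by positivity)).trans_eq ?_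
      ring
  have h := norm_image_sub_le_of_norm_deriv_le_segment_01'
    (f := fun t : ℝ => u (p + t • d)) (f' := fun t => fderiv ℝ u (p + t • d) d)
    (C := 64 * (n + 4) ^ 3 * M * ‖x‖ * x l)
    (fun t ht => (deriv_line ((hu.contDiffAt _ ⟨(hseg t ht).1.trans (by norm_num),
      (hseg t ht).2⟩).differentiableAt (by simp))).hasDerivWithinAt)
    (fun t ht => hbound _ (hseg t ⟨ht.1, ht.2.le⟩) (by simp [hdl, hp]))
  simpa [hd] using h

lemma exists_normal_slope (hu : IsHalfBallSol n 1 M u) (hM : 0 < M) :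
    ∃ a : ℝ, |a| ≤ 132 * (n + 4) ^ 4 * M ∧ ∀ t ∈ Set.Ioo (0 : ℝ) (5 / 8),
      |u (t • EuclideanSpace.single (Fin.last (n + 1)) (1 : ℝ)) - a * t| ≤
        512 * (n + 4) ^ 4 * M * t ^ 2 := by
  set e : EuclideanSpace ℝ (Fin (n + 2)) := EuclideanSpace.single (Fin.last (n + 1)) 1 with he
  have hnorm : ∀ t : ℝ, 0 ≤ t → ‖t • e‖ = t := fun t ht => by
    simp [he, norm_smul, abs_of_nonneg ht]
  have hmem : ∀ t ∈ Set.Ioo (0 : ℝ) (5 / 8), t • e ∈ halfBall n (5 / 8) := fun t ht =>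
    ⟨by rw [hnorm t ht.1.le]; exact ht.2, by simpa [he] using ht.1⟩
  have hmem1 : ∀ t ∈ Set.Ioo (0 : ℝ) (5 / 8), t • e ∈ halfBall n 1 := fun t ht =>
    ⟨(hmem t ht).1.trans (by norm_num), (hmem t ht).2⟩
  have hcont : ContinuousOn (fun t : ℝ => u (t • e)) (Set.Ico 0 (5 / 8)) := by
    refine hu.continuousOn.comp (by fun_prop) fun t ht => ?_
    rw [mem_halfBall_union_flatT, hnorm t ht.1]
    exact ⟨ht.2.trans (by norm_num), by simpa [he] using ht.1⟩
  have hf2 : ∀ t ∈ Set.Ioo (0 : ℝ) (5 / 8),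
      |deriv (deriv fun t : ℝ => u (t • e)) t| ≤ 512 * (n + 4) ^ 4 * M := by
    intro t ht
    have h := hu.abs_deriv_deriv_normal_le hM (hmem t ht)
    have h1 : deriv (fun s : ℝ => u (t • e + s • e)) =
        fun s => deriv (fun s => u (s • e)) (t + s) := by
      ext s
      simp only [← add_smul]
      exact deriv_comp_const_add (fun s => u (s • e)) t s
    rw [← he, h1, deriv_comp_const_add (deriv fun s => u (s • e)) t 0, add_zero] at h
    exact h
  obtain ⟨a, ha⟩ := exists_slope_of_deriv_deriv_le (by positivity) hcont
    (hu.eq_zero _ ⟨by simp, by simp⟩)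
    (fun t ht => ContDiffAt.comp (g := u) t (hu.contDiffAt _ (hmem1 t ht)) (by fun_prop)) hf2
  refine ⟨a, ?_, ha⟩
  have hq : (1 / 4 : ℝ) ∈ Set.Ioo (0 : ℝ) (5 / 8) := by constructor <;> norm_num
  have h1 := _root_.abs_le.1 (ha _ hq)
  have h2 := _root_.abs_le.1 (hu.abs_le _ (hmem1 _ hq))
  have h3 : M ≤ (n + 4) ^ 4 * M :=
    le_mul_of_one_le_left hM.le (one_le_pow₀ (by have := Nat.cast_nonneg (α := ℝ) n; linarith))
  rw [_root_.abs_le]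
  constructor <;> linarith

end IsHalfBallSol

theorem boundary_pointwise_C1alpha (n : ℕ) :
    ∃ α C : ℝ, 0 < α ∧ α < 1 ∧ 0 < C ∧
      ∀ (u : EuclideanSpace ℝ (Fin (n + 2)) → ℝ) (M : ℝ), 0 ≤ M →
        ContinuousOn u (halfBall n 1 ∪ flatT n 1) →
        IsHarmonicOn u (halfBall n 1) →
        (∀ x ∈ flatT n 1, u x = 0) →
        (∀ x ∈ halfBall n 1, |u x| ≤ M) →
        ∃ a : ℝ, |a| ≤ C * M ∧
          ∀ x ∈ halfBall n (1 / 2),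
            |u x - a * x (Fin.last (n + 1))| ≤ C * ‖x‖ ^ α * x (Fin.last (n + 1)) * M := by
  refine ⟨1 / 2, 576 * (n + 4) ^ 4, by norm_num, by norm_num, by positivity, ?_⟩
  intro u M hM0 hc hharm h0 hb
  rcases hM0.eq_or_lt with rfl | hM
  · refine ⟨0, by simp, fun x hx => ?_⟩
    simpa using hb x ⟨hx.1.trans (by norm_num), hx.2⟩
  have hu : IsHalfBallSol n 1 M u :=
    ⟨hc, fun x hx => hharm.1.contDiffAt ((isOpen_halfBall n 1).mem_nhds hx), hharm.2, h0, hb⟩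
  have hn : (1 : ℝ) ≤ n + 4 := by have := Nat.cast_nonneg (α := ℝ) n; linarith
  obtain ⟨a, ha, hat⟩ := hu.exists_normal_slope hM
  refine ⟨a, ha.trans (by gcongr; norm_num), fun x hx => ?_⟩
  have hxl : 0 < x (Fin.last (n + 1)) := hx.2
  have hxn : x (Fin.last (n + 1)) ≤ ‖x‖ := (le_abs_self _).trans (abs_apply_le_norm x _)
  have h1 := hu.abs_sub_normal_le hM (x := x) ⟨hx.1.trans (by norm_num), hx.2⟩
  have h2 := hat _ ⟨hxl, hxn.trans_lt (hx.1.trans (by norm_num))⟩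
  have hrpow : ‖x‖ ≤ ‖x‖ ^ (1 / 2 : ℝ) := by
    have := Real.rpow_le_rpow_of_exponent_ge' (norm_nonneg x) (hx.1.le.trans (by norm_num))
      (by norm_num : (0 : ℝ) ≤ 1 / 2) (by norm_num : (1 / 2 : ℝ) ≤ 1)
    rwa [Real.rpow_one] at this
  calc |u x - a * x (Fin.last (n + 1))|
      ≤ 64 * (n + 4) ^ 3 * M * ‖x‖ * x (Fin.last (n + 1)) +
        512 * (n + 4) ^ 4 * M * x (Fin.last (n + 1)) ^ 2 :=
        (abs_sub_le _ _ _).trans (add_le_add h1 h2)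
    _ ≤ 64 * (n + 4) ^ 4 * M * ‖x‖ * x (Fin.last (n + 1)) +
        512 * (n + 4) ^ 4 * M * (‖x‖ * x (Fin.last (n + 1))) := by
        rw [sq]
        gcongr
        · norm_num
    _ = 576 * (n + 4) ^ 4 * ‖x‖ * x (Fin.last (n + 1)) * M := by ring
    _ ≤ 576 * (n + 4) ^ 4 * ‖x‖ ^ (1 / 2 : ℝ) * x (Fin.last (n + 1)) * M := by gcongr
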